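/- Let F(x₀,x₁,x₂) = x₁x₂(x₀−x₁)·x₀·(x₀−x₁−x₂)·(x₀−x₂) and let H(x₀,x₁,x₂) = −bx₀⁵ + bx₀⁴x₁ + bx₀⁴x₂ − ex₀³x₁x₂ + ex₀²x₁²x₂ + ex₀²x₁x₂² + (−3b−e)x₀x₁²x₂² + bx₁³x₂² + bx₁²x₂³, viewed as polynomials in x₀ over ℚ[x₁,x₂,b,e]. Then the resultant of F and H with respect to x₀ equals, up to a nonzero rational constant, x₁¹²·x₂¹²·b³·(x₁−x₂)⁴·(x₁+x₂)²·(e+2b). -/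

import Mathlib

open Polynomial

/-- The Sylvester matrix of two polynomials `p` and `q`, regarded as having degrees
`m` and `n` respectively: an `(m+n) × (m+n)` matrix whose first `n` rows contain the
shifted coefficients of `p` and whose last `m` rows contain the shifted coefficients
of `q`. Its determinant is the resultant `Res_x(p, q)` (for `deg p = m`, `deg q = n`). -/
def sylvesterMatrix {R : Type*} [CommRing R] (m n : ℕ) (p q : R[X]) :
    Matrix (Fin (n + m)) (Fin (n + m)) R :=
  Matrix.of fun i j =>
    if (i : ℕ) < n then
      if (i : ℕ) ≤ (j : ℕ) ∧ (j : ℕ) ≤ (i : ℕ) + m then p.coeff (m - ((j : ℕ) - (i : ℕ)))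
      else 0
    else
      if ((i : ℕ) - n) ≤ (j : ℕ) ∧ (j : ℕ) ≤ ((i : ℕ) - n) + n then
        q.coeff (n - ((j : ℕ) - ((i : ℕ) - n)))
      else 0

/-- The resultant of `p` (of degree `m`) and `q` (of degree `n`) with respect to
their common variable, as the determinant of the Sylvester matrix. -/
def resultantAux {R : Type*} [CommRing R] (m n : ℕ) (p q : R[X]) : R :=
  (sylvesterMatrix m n p q).det

/-- Base ring `ℚ[x₁, x₂, b, e]`. -/
noncomputable abbrev Rng : Type := MvPolynomial (Fin 4) ℚ

noncomputable abbrev x₁ : Rng := MvPolynomial.X 0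
noncomputable abbrev x₂ : Rng := MvPolynomial.X 1
noncomputable abbrev bb : Rng := MvPolynomial.X 2
noncomputable abbrev ee : Rng := MvPolynomial.X 3

/-- The branch sextic `F = x₁x₂(x₀−x₁)·x₀·(x₀−x₁−x₂)·(x₀−x₂)` as a polynomial in
`x₀` over `ℚ[x₁,x₂,b,e]`; it has degree 4 in `x₀`. -/
noncomputable def Fpoly : Rng[X] :=
  C (x₁ * x₂) * (X - C x₁) * X * (X - C x₁ - C x₂) * (X - C x₂)

/-- The splitting genus 1 pencil of quintics `H`, as a polynomial in `x₀` over
`ℚ[x₁,x₂,b,e]`; it has degree 5 in `x₀`. -/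
noncomputable def Hpoly : Rng[X] :=
  C (-bb) * X^5 + C (bb * x₁) * X^4 + C (bb * x₂) * X^4
    + C (-(ee * x₁ * x₂)) * X^3 + C (ee * x₁^2 * x₂) * X^2 + C (ee * x₁ * x₂^2) * X^2
    + C ((-3*bb - ee) * x₁^2 * x₂^2) * X + C (bb * x₁^3 * x₂^2) + C (bb * x₁^2 * x₂^3)

set_option maxHeartbeats 4000000 in
/-- The frozen resultant agrees with Mathlib's resultant (rows and columns reversed, transposed). -/
lemma resultantAux_eq_resultant {R : Type*} [CommRing R] (p q : R[X]) :
    resultantAux 4 5 p q = Polynomial.resultant p q 4 5 := by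
  have h : sylvesterMatrix 4 5 p q =
      ((Polynomial.sylvester p q 4 5).transpose).submatrix
        (Fin.revPerm : Equiv.Perm (Fin 9)) (Fin.revPerm : Equiv.Perm (Fin 9)) := by
    ext i j
    change Fin 9 at i j
    fin_cases i <;> fin_cases j <;>
      simp [sylvesterMatrix, Polynomial.sylvester, Fin.addCases, Fin.rev]
  unfold resultantAux Polynomial.resultant
  rw [h]
  exact (Matrix.det_submatrix_equiv_self _ _).trans (Matrix.det_transpose _)

lemma Hpoly_natDegree_le : Hpoly.natDegree ≤ 5 := by
  unfold Hpoly
  compute_degree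

lemma Hpoly_eval (r : Rng) : Hpoly.eval r =
    (-bb) * r^5 + (bb * x₁) * r^4 + (bb * x₂) * r^4
    + (-(ee * x₁ * x₂)) * r^3 + (ee * x₁^2 * x₂) * r^2 + (ee * x₁ * x₂^2) * r^2
    + ((-3*bb - ee) * x₁^2 * x₂^2) * r + (bb * x₁^3 * x₂^2) + (bb * x₁^2 * x₂^3) := by
  unfold Hpoly
  simp only [eval_add, eval_mul, eval_pow, eval_C, eval_X]

lemma resultant_linear_mul (r : Rng) (f : Rng[X]) (m : ℕ) (hf : f.natDegree = m) :
    Polynomial.resultant ((X - C r) * f) Hpoly (1 + m) 5 =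
      Hpoly.eval r * Polynomial.resultant f Hpoly m 5 := by
  have h := Polynomial.resultant_mul_left (X - C r) f Hpoly 5 Hpoly_natDegree_le
  rw [natDegree_X_sub_C, hf, resultant_X_sub_C_left _ _ _ Hpoly_natDegree_le] at h
  exact h

/-- The resultant of `F` and `H` with respect to `x₀` equals, up to a nonzero
rational constant, `x₁¹²·x₂¹²·b³·(x₁−x₂)⁴·(x₁+x₂)²·(e+2b)`. -/
theorem resultant_of_branch_sextic_and_pencil :
    ∃ c : ℚ, c ≠ 0 ∧
      resultantAux 4 5 Fpoly Hpoly =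
        MvPolynomial.C c *
          (x₁^12 * x₂^12 * bb^3 * (x₁ - x₂)^4 * (x₁ + x₂)^2 * (ee + 2*bb)) := by
  refine ⟨-1, by norm_num, ?_⟩
  have hF : Fpoly = C (x₁ * x₂) * ((X - C x₁) * ((X - C 0) * ((X - C (x₁ + x₂)) * (X - C x₂)))) := by
    unfold Fpoly
    simp only [C_add, C_0, sub_zero]
    ring
  have d1 : (X - C x₂ : Rng[X]).natDegree = 1 := natDegree_X_sub_C _
  have d2 : ((X - C (x₁ + x₂)) * (X - C x₂) : Rng[X]).natDegree = 2 := by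
    rw [(monic_X_sub_C _).natDegree_mul (monic_X_sub_C _)]; simp only [natDegree_X_sub_C]
  have d3 : ((X - C 0) * ((X - C (x₁ + x₂)) * (X - C x₂)) : Rng[X]).natDegree = 3 := by
    rw [(monic_X_sub_C _).natDegree_mul ((monic_X_sub_C _).mul (monic_X_sub_C _)), d2,
      natDegree_X_sub_C]
  rw [resultantAux_eq_resultant, hF, resultant_C_mul_left,
    resultant_linear_mul _ _ 3 d3, resultant_linear_mul _ _ 2 d2,
    resultant_linear_mul _ _ 1 d1, resultant_X_sub_C_left _ _ _ Hpoly_natDegree_le]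
  have hc : (MvPolynomial.C (-1 : ℚ) : Rng) = -1 := by rw [MvPolynomial.C_neg, MvPolynomial.C_1]
  rw [hc]
  rw [Hpoly_eval, Hpoly_eval, Hpoly_eval, Hpoly_eval]
  generalize x₁ = u
  generalize x₂ = v
  generalize bb = b
  generalize ee = e
  ring
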